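/- arXiv:1308.3298 — 2 statements merged into one kernel-verified Lean document; each statement's English description precedes it below -/
import Mathlib

section
/- Let γ = 0, so U₀ = U − b b₁*. For every λ in the open unit disc 𝔻, the characteristic function θ₀ of U₀, computed with respect to the basis vectors b₁ ∈ 𝔇_{U₀} and b ∈ 𝔇_{U₀*}, satisfies θ₀(λ) = R₁μ(λ)/(1 + R₁μ(λ)) = (R₂μ(λ) − 1)/(R₂μ(λ) + 1); equivalently, (−U₀ + λ D_{U₀*}(I − λU₀*)⁻¹ D_{U₀}) b₁ = [R₁μ(λ)/(1 + R₁μ(λ))] · b in L²(μ). -/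
open MeasureTheory Complex Filter Metric ContinuousLinearMap
open scoped ComplexConjugate ENNReal NNReal

noncomputable section

/-- The rank one operator `f ↦ ⟨f, y⟩ x` (inner product linear in the first slot,
as in the paper). -/
def rankOne {H : Type*} [NormedAddCommGroup H] [InnerProductSpace ℂ H] (x y : H) :
    H →L[ℂ] H :=
  (innerSL ℂ y).smulRight x

/-- The Cauchy type transform `R₁τ(λ) = ∫ ξ̄λ/(1-ξ̄λ) dτ(ξ)`. -/
def R1t (μ : Measure ℂ) (lam : ℂ) : ℂ :=
  ∫ ξ, (conj ξ * lam) / (1 - conj ξ * lam) ∂μ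

/-- The Cauchy type transform `R₂τ(λ) = ∫ (1+ξ̄λ)/(1-ξ̄λ) dτ(ξ)`. -/
def R2t (μ : Measure ℂ) (lam : ℂ) : ℂ :=
  ∫ ξ, (1 + conj ξ * lam) / (1 - conj ξ * lam) ∂μ

section Hilbert

variable {H : Type*} [NormedAddCommGroup H] [InnerProductSpace ℂ H]

theorem rankOne_apply (x y f : H) : rankOne x y f = inner ℂ y f • x := rfl

theorem ContinuousLinearMap.IsPositive.eq_self_of_apply_apply_eq {D : H →L[ℂ] H}
    (hD : D.IsPositive) {v : H} (hv : D (D v) = v) : D v = v := by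
  have hneg : D (D v - v) = -(D v - v) := by rw [map_sub, hv]; abel
  have h := hD.re_inner_nonneg_left (D v - v)
  rw [hneg, inner_neg_left, map_neg, inner_self_eq_norm_sq (𝕜 := ℂ)] at h
  have : ‖D v - v‖ = 0 := by nlinarith [norm_nonneg (D v - v)]
  exact sub_eq_zero.mp (norm_eq_zero.mp this)

theorem ContinuousLinearMap.IsPositive.eq_rankOne_of_comp_self {D : H →L[ℂ] H}
    (hD : D.IsPositive) {v : H} (hv : ‖v‖ = 1) (h : D ∘L D = rankOne v v) :
    D = rankOne v v := by
  have hsq (f : H) : D (D f) = inner ℂ v f • v := DFunLike.congr_fun h f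
  have hvv : inner ℂ v v = 1 := by simp [inner_self_eq_norm_sq_to_K, hv]
  have hDv : D v = v := hD.eq_self_of_apply_apply_eq (by rw [hsq, hvv, one_smul])
  ext f
  set w := f - (inner ℂ v f : ℂ) • v with hw
  have hDDw : D (D w) = 0 := by
    rw [hsq, hw, inner_sub_right, inner_smul_right, hvv, mul_one, sub_self, zero_smul]
  have hDw : D w = 0 := by
    rw [← inner_self_eq_zero (𝕜 := ℂ)]
    have := hD.isSymmetric (D w) w
    simp only [ContinuousLinearMap.coe_coe] at this
    rw [← this, hDDw, inner_zero_left]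
  rw [hw, map_sub, map_smul, hDv, sub_eq_zero] at hDw
  rw [hDw, rankOne_apply]

theorem norm_eq_one_of_inner_self {v : H} (hv : inner ℂ v v = (1 : ℂ)) : ‖v‖ = 1 := by
  rw [norm_eq_sqrt_re_inner (𝕜 := ℂ), hv, RCLike.one_re, Real.sqrt_one]

variable [CompleteSpace H]

theorem adjoint_rankOne (x y : H) : adjoint (rankOne x y) = rankOne y x := by
  refine ((eq_adjoint_iff _ _).mpr fun f g => ?_).symm
  simp only [rankOne_apply, inner_smul_left, inner_smul_right, inner_conj_symm]
  ring

theorem norm_le_one_of_comp_self_eq {T D : H →L[ℂ] H} (hD : D.IsPositive)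
    (h : D ∘L D = 1 - adjoint T ∘L T) : ‖T‖ ≤ 1 := by
  refine T.opNorm_le_bound zero_le_one fun f => ?_
  have hf : D (D f) = f - adjoint T (T f) := DFunLike.congr_fun h f
  have hsymm := hD.isSymmetric (D f) f
  simp only [ContinuousLinearMap.coe_coe] at hsymm
  rw [hf, inner_sub_left, adjoint_inner_left] at hsymm
  have hre := congrArg RCLike.re hsymm
  rw [map_sub, inner_self_eq_norm_sq (𝕜 := ℂ), inner_self_eq_norm_sq (𝕜 := ℂ),
    inner_self_eq_norm_sq (𝕜 := ℂ)] at hre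
  rw [one_mul]
  exact le_of_sq_le_sq (by nlinarith [sq_nonneg ‖D f‖]) (norm_nonneg f)

/-- For a unitary `U` with `U b₁ = b`, `‖b‖ = 1`, the characteristic function of `U - b b₁*` at
`lam` is `lam * ⟨b, x⟩`, where `x` solves `U x - lam x = (1 - lam * ⟨b, x⟩) b`. -/
theorem exists_characteristic_apply_eq {U : H →L[ℂ] H} (hU : adjoint U ∘L U = 1)
    (hU' : U ∘L adjoint U = 1) {b b₁ : H} (hb : U b₁ = b) (hb_norm : ‖b‖ = 1)
    {D Dstar : H →L[ℂ] H} (hDpos : D.IsPositive)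
    (hDsq : D ∘L D = 1 - adjoint (U - rankOne b b₁) ∘L (U - rankOne b b₁))
    (hDspos : Dstar.IsPositive)
    (hDssq : Dstar ∘L Dstar = 1 - (U - rankOne b b₁) ∘L adjoint (U - rankOne b b₁))
    {lam : ℂ} (hlam : ‖lam‖ < 1) :
    ∃ x : H,
      (-(U - rankOne b b₁) + lam •
        (Dstar ∘L Ring.inverse (1 - lam • adjoint (U - rankOne b b₁)) ∘L D)) b₁
          = (lam * inner ℂ b x) • b ∧
      U x - lam • x = (1 - lam * inner ℂ b x) • b := by
  have hUadj (f : H) : U (adjoint U f) = f := DFunLike.congr_fun hU' f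
  have hadjU (f : H) : adjoint U (U f) = f := DFunLike.congr_fun hU f
  have hb' : adjoint U b = b₁ := by rw [← hb, hadjU]
  have hbb : inner ℂ b b = 1 := by simp [inner_self_eq_norm_sq_to_K, hb_norm]
  have hb₁b₁ : inner ℂ b₁ b₁ = (1 : ℂ) := by
    rw [← hbb]
    nth_rewrite 1 [← hb']
    rw [adjoint_inner_left, hb]
  have hb₁_norm : ‖b₁‖ = 1 := norm_eq_one_of_inner_self hb₁b₁
  have hadj : adjoint (U - rankOne b b₁) = adjoint U - rankOne b₁ b := by
    rw [map_sub, adjoint_rankOne]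
  have hA : IsUnit (1 - lam • adjoint (U - rankOne b b₁)) := by
    refine isUnit_one_sub_of_norm_lt_one ((norm_smul_le _ _).trans_lt ?_)
    rw [LinearIsometryEquiv.norm_map]
    have := norm_le_one_of_comp_self_eq hDpos hDsq
    nlinarith [norm_nonneg lam]
  have hD : D = rankOne b₁ b₁ := by
    refine hDpos.eq_rankOne_of_comp_self hb₁_norm (hDsq.trans ?_)
    ext f
    have : inner ℂ b (U f) = inner ℂ b₁ f := by rw [← adjoint_inner_left, hb']
    simp [hadj, rankOne_apply, hadjU, hb', hb_norm, this]
  have hDs : Dstar = rankOne b b := by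
    refine hDspos.eq_rankOne_of_comp_self hb_norm (hDssq.trans ?_)
    ext f
    have : inner ℂ b₁ (adjoint U f) = inner ℂ b f := by rw [adjoint_inner_right, hb]
    simp [hadj, rankOne_apply, hUadj, hb, hb₁_norm, this]
  set A := 1 - lam • adjoint (U - rankOne b b₁) with hAdef
  refine ⟨Ring.inverse A b₁, ?_, ?_⟩
  · simp [hD, hDs, rankOne_apply, hb, hb₁_norm, smul_smul]
  · set x := Ring.inverse A b₁ with hx
    have hAx : A x = b₁ := by
      rw [hx]
      exact DFunLike.congr_fun (Ring.mul_inverse_cancel A hA) b₁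
    rw [hAdef, hadj] at hAx
    have := congrArg U hAx
    simp only [sub_apply, smul_apply, one_apply_eq_self, rankOne_apply, map_sub, map_smul, hUadj, hb]
      at this
    rw [sub_smul, one_smul, mul_smul]
    linear_combination (norm := module) this

end Hilbert

section Multiplication

variable {μ : Measure ℂ}

theorem one_sub_conj_mul_ne_zero_and_norm_div_le {ξ lam : ℂ} (hξ : ‖ξ‖ = 1) (hlam : ‖lam‖ < 1) :
    1 - conj ξ * lam ≠ 0 ∧
      ‖(conj ξ * lam) / (1 - conj ξ * lam)‖ ≤ 1 / (1 - ‖lam‖) := by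
  have hnorm : ‖conj ξ * lam‖ = ‖lam‖ := by rw [norm_mul, RCLike.norm_conj, hξ, one_mul]
  have hge : 1 - ‖lam‖ ≤ ‖1 - conj ξ * lam‖ := by
    simpa only [hnorm, norm_one] using norm_sub_norm_le (1 : ℂ) (conj ξ * lam)
  have hpos : 0 < 1 - ‖lam‖ := sub_pos.mpr hlam
  refine ⟨norm_pos_iff.mp (hpos.trans_le hge), ?_⟩
  rw [norm_div, hnorm]
  exact div_le_div₀ zero_le_one hlam.le hpos hge

theorem R2t_eq [IsProbabilityMeasure μ] (hμ : ∀ᵐ ξ ∂μ, ‖ξ‖ = 1) {lam : ℂ} (hlam : ‖lam‖ < 1) :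
    R2t μ lam = 1 + 2 * R1t μ lam := by
  have hint : Integrable (fun ξ => (conj ξ * lam) / (1 - conj ξ * lam)) μ := by
    refine Integrable.of_bound (C := 1 / (1 - ‖lam‖)) ?_ ?_
    · exact Measurable.aestronglyMeasurable (by fun_prop)
    · filter_upwards [hμ] with ξ hξ using (one_sub_conj_mul_ne_zero_and_norm_div_le hξ hlam).2
  have h : R2t μ lam = ∫ ξ, (1 + 2 * ((conj ξ * lam) / (1 - conj ξ * lam))) ∂μ := by
    refine integral_congr_ae ?_
    filter_upwards [hμ] with ξ hξ
    have := (one_sub_conj_mul_ne_zero_and_norm_div_le hξ hlam).1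
    field_simp
    ring
  rw [h, integral_add (integrable_const _) (hint.const_mul 2), integral_const_mul]
  simp [R1t]

variable {U : Lp ℂ 2 μ →L[ℂ] Lp ℂ 2 μ}

theorem adjoint_comp_self_of_ae_eq_mul (hμ : ∀ᵐ ξ ∂μ, ‖ξ‖ = 1)
    (hU : ∀ f : Lp ℂ 2 μ, ∀ᵐ ξ ∂μ, (U f) ξ = ξ * f ξ) : adjoint U ∘L U = 1 := by
  ext1 f
  refine ext_inner_right ℂ fun g => ?_
  rw [comp_apply, adjoint_inner_left, one_apply_eq_self, L2.inner_def, L2.inner_def]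
  refine integral_congr_ae ?_
  filter_upwards [hU f, hU g, hμ] with ξ hf hg hξ
  have : conj ξ * ξ = 1 := by rw [Complex.conj_mul', hξ]; simp
  simp only [hf, hg, RCLike.inner_apply, map_mul]
  linear_combination (g ξ * conj (f ξ)) * this

theorem surjective_of_ae_eq_mul (hμ : ∀ᵐ ξ ∂μ, ‖ξ‖ = 1)
    (hU : ∀ f : Lp ℂ 2 μ, ∀ᵐ ξ ∂μ, (U f) ξ = ξ * f ξ) : Function.Surjective U := by
  intro f
  have hg : MemLp (fun ξ => conj ξ * f ξ) 2 μ := by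
    refine (Lp.memLp f).of_le
      ((Continuous.aestronglyMeasurable (by fun_prop)).mul (Lp.aestronglyMeasurable f)) ?_
    filter_upwards [hμ] with ξ hξ
    simp [hξ]
  refine ⟨hg.toLp, Lp.ext ?_⟩
  filter_upwards [hU hg.toLp, hg.coeFn_toLp, hμ] with ξ h₁ h₂ hξ
  rw [h₁, h₂, ← mul_assoc, Complex.mul_conj', hξ]
  simp

theorem comp_adjoint_self_of_ae_eq_mul (hμ : ∀ᵐ ξ ∂μ, ‖ξ‖ = 1)
    (hU : ∀ f : Lp ℂ 2 μ, ∀ᵐ ξ ∂μ, (U f) ξ = ξ * f ξ) : U ∘L adjoint U = 1 := by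
  ext1 f
  obtain ⟨g, rfl⟩ := surjective_of_ae_eq_mul hμ hU f
  exact congrArg U (DFunLike.congr_fun (adjoint_comp_self_of_ae_eq_mul hμ hU) g)

theorem mul_inner_eq_mul_R1t (hμ : ∀ᵐ ξ ∂μ, ‖ξ‖ = 1)
    (hU : ∀ f : Lp ℂ 2 μ, ∀ᵐ ξ ∂μ, (U f) ξ = ξ * f ξ) {b : Lp ℂ 2 μ}
    (hb : ∀ᵐ ξ ∂μ, b ξ = 1) {lam : ℂ} (hlam : ‖lam‖ < 1) {x : Lp ℂ 2 μ} {a : ℂ}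
    (hx : U x - lam • x = a • b) : lam * inner ℂ b x = a * R1t μ lam := by
  rw [L2.inner_def, R1t, ← integral_const_mul, ← integral_const_mul]
  refine integral_congr_ae ?_
  have hae : ∀ᵐ ξ ∂μ, (U x - lam • x) ξ = (a • b) ξ := by rw [hx]; simp
  filter_upwards [hae, Lp.coeFn_sub (U x) (lam • x), Lp.coeFn_smul lam x, Lp.coeFn_smul a b,
    hU x, hb, hμ] with ξ h hsub hsmul hsmul' hUx hbξ hξ
  have hne := (one_sub_conj_mul_ne_zero_and_norm_div_le hξ hlam).1
  have hconj : conj ξ * ξ = 1 := by rw [Complex.conj_mul', hξ]; simp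
  rw [hsub, hsmul', Pi.sub_apply, hsmul, Pi.smul_apply, Pi.smul_apply, hUx, hbξ] at h
  simp only [smul_eq_mul, mul_one] at h
  simp only [RCLike.inner_apply, hbξ, map_one, mul_one]
  rw [← mul_div_assoc, eq_div_iff hne]
  linear_combination lam * conj ξ * h - lam * x ξ * hconj

end Multiplication

/-- For `γ = 0`, i.e. `U₀ = U - b b₁*`, the characteristic function of `U₀`
with respect to the basis vectors `b₁` of `𝔇_{U₀}` and `b` of `𝔇_{U₀*}` is
`θ₀(λ) = R₁μ(λ)/(1+R₁μ(λ)) = (R₂μ(λ)-1)/(R₂μ(λ)+1)` for `λ ∈ 𝔻`.  The defect operators are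
encoded as the (unique) positive square roots of `I - U₀*U₀`, resp. `I - U₀U₀*`. -/
theorem statement0
    (μ : Measure ℂ) [IsProbabilityMeasure μ] (hμ : ∀ᵐ ξ ∂μ, ‖ξ‖ = 1)
    (U : Lp ℂ 2 μ →L[ℂ] Lp ℂ 2 μ)
    (hU : ∀ f : Lp ℂ 2 μ, ∀ᵐ ξ ∂μ, (U f) ξ = ξ * f ξ)
    (b b₁ : Lp ℂ 2 μ)
    (hb : ∀ᵐ ξ ∂μ, b ξ = 1) (hb₁ : ∀ᵐ ξ ∂μ, b₁ ξ = conj ξ)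
    (U₀ : Lp ℂ 2 μ →L[ℂ] Lp ℂ 2 μ) (hU₀ : U₀ = U - rankOne b b₁)
    -- the defect operator `D_{U₀} = (I - U₀*U₀)^{1/2}`:
    (D : Lp ℂ 2 μ →L[ℂ] Lp ℂ 2 μ)
    (hDpos : D.IsPositive) (hDsq : D ∘L D = 1 - adjoint U₀ ∘L U₀)
    -- the defect operator `D_{U₀*} = (I - U₀U₀*)^{1/2}`:
    (Dstar : Lp ℂ 2 μ →L[ℂ] Lp ℂ 2 μ)
    (hDspos : Dstar.IsPositive) (hDssq : Dstar ∘L Dstar = 1 - U₀ ∘L adjoint U₀)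
    (lam : ℂ) (hlam : ‖lam‖ < 1) :
    (-U₀ + lam • (Dstar ∘L Ring.inverse (1 - lam • adjoint U₀) ∘L D)) b₁
        = (R1t μ lam / (1 + R1t μ lam)) • b ∧
      R1t μ lam / (1 + R1t μ lam) = (R2t μ lam - 1) / (R2t μ lam + 1) := by
  have hUb : U b₁ = b := by
    refine Lp.ext ?_
    filter_upwards [hU b₁, hb, hb₁, hμ] with ξ h₁ h₂ h₃ hξ
    rw [h₁, h₂, h₃, Complex.mul_conj', hξ]
    simp
  have hb_norm : ‖b‖ = 1 := by
    have hbb : inner ℂ b b = (1 : ℂ) := by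
      rw [L2.inner_def]
      calc ∫ ξ, inner ℂ (b ξ) (b ξ) ∂μ = ∫ _, (1 : ℂ) ∂μ := by
            refine integral_congr_ae ?_
            filter_upwards [hb] with ξ hξ
            simp [hξ]
        _ = 1 := by simp
    exact norm_eq_one_of_inner_self hbb
  subst hU₀
  obtain ⟨x, hθ, hx⟩ := exists_characteristic_apply_eq
    (adjoint_comp_self_of_ae_eq_mul hμ hU) (comp_adjoint_self_of_ae_eq_mul hμ hU)
    hUb hb_norm hDpos hDsq hDspos hDssq hlam
  have hR := mul_inner_eq_mul_R1t hμ hU hb hlam hx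
  have hne : 1 + R1t μ lam ≠ 0 := by
    intro h0
    have : R1t μ lam = 0 := by linear_combination lam * inner ℂ b x * h0 - hR
    simp [this] at h0
  constructor
  · rw [hθ]
    congr 1
    rw [eq_div_iff hne]
    linear_combination hR
  · rw [R2t_eq hμ hlam, show 1 + 2 * R1t μ lam - 1 = 2 * R1t μ lam by ring,
      show 1 + 2 * R1t μ lam + 1 = 2 * (1 + R1t μ lam) by ring,
      mul_div_mul_left _ _ two_ne_zero]
end
end

section
/- Let |γ| < 1 and let v(z) = ‖B_γ(z)‖²_{ℂ²} for z ∈ 𝕋. Then the kernel K(z, ξ) = 1/(1 − ξ̄z) is restrictedly bounded from L²(μ) to L²(v dm) with restricted norm at most 1: for all bounded measurable functions f and ψ on 𝕋 with disjoint compact supports, |∫_𝕋∫_𝕋 [1/(1 − ξ̄z)]·f(ξ)·conj(ψ(z))·v(z) dμ(ξ) dm(z)| ≤ ‖f‖_{L²(μ)}·‖ψ‖_{L²(v dm)}. -/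
open MeasureTheory Complex Filter Metric ContinuousLinearMap
open scoped ComplexConjugate ENNReal NNReal Topology

noncomputable section

/-- Normalized Lebesgue (arclength) measure on the unit circle, as a measure on `ℂ`. -/
def circleMeasure : Measure ℂ :=
  (ENNReal.ofReal (2 * Real.pi)⁻¹) •
    Measure.map (fun t : ℝ => Complex.exp (t * Complex.I))
      (volume.restrict (Set.Ioc 0 (2 * Real.pi)))

/-- `f` has nontangential limit `L` at the boundary point `z` from inside the unit disc:
convergence along every Stolz angle at `z`. -/
def NTlimIn (f : ℂ → ℂ) (z L : ℂ) : Prop :=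
  ∀ C : ℝ, 1 < C →
    Tendsto f (𝓝[{w : ℂ | ‖w‖ < 1 ∧ ‖w - z‖ ≤ C * (1 - ‖w‖)}] z) (𝓝 L)

/-- `f` has nontangential limit `L` at the boundary point `z` from outside the unit disc. -/
def NTlimOut (f : ℂ → ℂ) (z L : ℂ) : Prop :=
  ∀ C : ℝ, 1 < C →
    Tendsto f (𝓝[{w : ℂ | 1 < ‖w‖ ∧ ‖w - z‖ ≤ C * (‖w‖ - 1)}] z) (𝓝 L)

/-- `θ_γ(λ) = -γ + (1-|γ|²)R₁μ(λ)/(1 + (1-γ̄)R₁μ(λ))`, the characteristic function of `U_γ`. -/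
def thetaG (γ : ℂ) (μ : Measure ℂ) (lam : ℂ) : ℂ :=
  -γ + (1 - (‖γ‖ : ℂ) ^ 2) * R1t μ lam / (1 + (1 - conj γ) * R1t μ lam)

/-- First component of `B_γ(z) = c^γ(z) - z c₁^γ(z)`, written in terms of the boundary
values `Θγ` of `θ_γ`. -/
def BgammaFst (γ : ℂ) (Θγ : ℂ → ℂ) (z : ℂ) : ℂ :=
  ((Real.sqrt (1 - ‖γ‖ ^ 2))⁻¹ : ℂ) * (1 + (conj γ - 1) * Θγ z - γ)

/-- Second component of `B_γ(z) = c^γ(z) - z c₁^γ(z)`. -/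
def BgammaSnd (γ : ℂ) (Θγ : ℂ → ℂ) (z : ℂ) : ℂ :=
  ((Real.sqrt (1 - ‖γ‖ ^ 2))⁻¹ : ℂ) *
    ((conj γ - 1) * (Real.sqrt (1 - ‖Θγ z‖ ^ 2) : ℂ))

/-- The weight `v(z) = ‖B_γ(z)‖²_{ℂ²}`. -/
def vWeight (γ : ℂ) (Θγ : ℂ → ℂ) (z : ℂ) : ℝ :=
  ‖BgammaFst γ Θγ z‖ ^ 2 + ‖BgammaSnd γ Θγ z‖ ^ 2

/-- The Cauchy transform `λ ↦ ∫ g(ξ)/(1-ξ̄λ) dμ(ξ)`. -/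
def cauchyT (μ : Measure ℂ) (g : ℂ → ℂ) (w : ℂ) : ℂ :=
  ∫ ξ, g ξ / (1 - conj ξ * w) ∂μ

/-- The reciprocal (up to the factor `1-γ̄`) of the denominator of `θ_γ`. -/
def qG (γ : ℂ) (μ : Measure ℂ) (w : ℂ) : ℂ :=
  (1 - conj γ) / (1 + (1 - conj γ) * R1t μ w)

/-- The Poisson kernel of the unit disc. -/
def discPoisson (w ξ : ℂ) : ℝ := (1 - ‖w‖ ^ 2) / ‖1 - conj ξ * w‖ ^ 2

theorem one_sub_norm_le_norm_one_sub_conj_mul {ξ w : ℂ} (hξ : ‖ξ‖ = 1) :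
    1 - ‖w‖ ≤ ‖1 - conj ξ * w‖ := by
  have h := norm_sub_norm_le (1 : ℂ) (conj ξ * w)
  rwa [norm_mul, RCLike.norm_conj, hξ, one_mul, norm_one] at h

theorem norm_integral_le_sqrt_mul_sqrt {α : Type*} [MeasurableSpace α] {ν : Measure α}
    {A B : α → ℝ} {h : α → ℂ} (hA : Integrable A ν) (hB : Integrable B ν)
    (hA0 : 0 ≤ᵐ[ν] A) (hB0 : 0 ≤ᵐ[ν] B) (hAB : ∀ᵐ x ∂ν, ‖h x‖ ^ 2 ≤ A x * B x) :
    ‖∫ x, h x ∂ν‖ ≤ Real.sqrt (∫ x, A x ∂ν) * Real.sqrt (∫ x, B x ∂ν) := by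
  have hmem : ∀ {D : α → ℝ}, Integrable D ν → 0 ≤ᵐ[ν] D →
      MemLp (fun x => Real.sqrt (D x)) 2 ν := by
    intro D hD hD0
    rw [memLp_two_iff_integrable_sq
      (Real.continuous_sqrt.comp_aestronglyMeasurable hD.aestronglyMeasurable)]
    refine hD.congr ?_
    filter_upwards [hD0] with x hx
    exact (Real.sq_sqrt hx).symm
  have hsq : ∀ {D : α → ℝ}, 0 ≤ᵐ[ν] D →
      ∫ x, (Real.sqrt (D x)) ^ (2 : ℝ) ∂ν = ∫ x, D x ∂ν := by
    intro D hD0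
    refine integral_congr_ae ?_
    filter_upwards [hD0] with x hx
    rw [Real.rpow_two, Real.sq_sqrt hx]
  have key := integral_mul_le_Lp_mul_Lq_of_nonneg (μ := ν) Real.HolderConjugate.two_two
    (f := fun x => Real.sqrt (A x)) (g := fun x => Real.sqrt (B x))
    (Eventually.of_forall fun _ => Real.sqrt_nonneg _)
    (Eventually.of_forall fun _ => Real.sqrt_nonneg _)
    (by simpa using hmem hA hA0) (by simpa using hmem hB hB0)
  rw [hsq hA0, hsq hB0, ← Real.sqrt_eq_rpow, ← Real.sqrt_eq_rpow] at key
  refine (norm_integral_le_of_norm_le ((hmem hA hA0).integrable_mul (hmem hB hB0)) ?_).trans key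
  filter_upwards [hAB, hA0] with x hx hx0
  have : ‖h x‖ ≤ Real.sqrt (A x * B x) := Real.le_sqrt_of_sq_le hx
  rwa [Real.sqrt_mul hx0] at this

theorem circleMeasure_eq_map_circleMap :
    circleMeasure = (ENNReal.ofReal (2 * Real.pi)⁻¹) •
      Measure.map (circleMap 0 1) (volume.restrict (Set.Ioc 0 (2 * Real.pi))) := by
  have : (fun t : ℝ => Complex.exp (t * Complex.I)) = circleMap 0 1 := by
    ext t; simp [circleMap]
  rw [circleMeasure, this]

instance isFiniteMeasure_circleMeasure : IsFiniteMeasure circleMeasure := by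
  rw [circleMeasure_eq_map_circleMap]
  exact Measure.smul_finite _ ENNReal.ofReal_ne_top

theorem ae_norm_eq_one_circleMeasure : ∀ᵐ z ∂circleMeasure, ‖z‖ = 1 := by
  rw [circleMeasure_eq_map_circleMap]
  refine Measure.ae_smul_measure ?_ _
  rw [ae_map_iff (measurable_circleMap 0 1).aemeasurable
    (measurableSet_eq_fun measurable_norm measurable_const)]
  exact Eventually.of_forall fun t => by simp [norm_circleMap_zero]

theorem integral_circleMeasure {E : Type*} [NormedAddCommGroup E] [NormedSpace ℝ E] {g : ℂ → E}
    (hg : StronglyMeasurable g) : ∫ z, g z ∂circleMeasure = Real.circleAverage g 0 1 := by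
  rw [circleMeasure_eq_map_circleMap, integral_smul_measure,
    integral_map (measurable_circleMap 0 1).aemeasurable hg.aestronglyMeasurable,
    Real.circleAverage_def, intervalIntegral.integral_of_le Real.two_pi_pos.le,
    ENNReal.toReal_ofReal (by positivity)]

theorem integrable_comp_mul_circleMeasure {H : ℂ → ℂ} (hH : DifferentiableOn ℂ H (ball 0 1))
    (hm : Measurable H) {r : ℝ} (hr : 0 < r) (hr1 : r < 1) :
    Integrable (fun z => H (r * z)) circleMeasure := by
  obtain ⟨C, hC⟩ := (isCompact_closedBall (0 : ℂ) r).exists_bound_of_continuousOn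
    (hH.continuousOn.mono (closedBall_subset_ball hr1))
  refine Integrable.of_bound
    (hm.comp (measurable_const.mul measurable_id)).aestronglyMeasurable C ?_
  filter_upwards [ae_norm_eq_one_circleMeasure] with z hz
  exact hC _ (by simp [hz, abs_of_pos hr])

theorem integral_comp_mul_circleMeasure {H : ℂ → ℂ} (hH : DifferentiableOn ℂ H (ball 0 1))
    (hm : Measurable H) {r : ℝ} (hr : 0 < r) (hr1 : r < 1) :
    ∫ z, H (r * z) ∂circleMeasure = H 0 := by
  have hm' : Measurable fun z => H (r * z) := hm.comp (measurable_const.mul measurable_id)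
  rw [integral_circleMeasure hm'.stronglyMeasurable]
  have hd : DiffContOnCl ℂ (fun z => H (r * z)) (ball 0 |1|) := by
    refine DifferentiableOn.diffContOnCl ?_
    refine hH.comp (by fun_prop) ?_
    intro z hz
    have hz' := closure_ball_subset_closedBall hz
    simp only [abs_one, mem_closedBall, dist_zero_right] at hz'
    simp only [mem_ball, dist_zero_right, norm_mul, norm_real, Real.norm_eq_abs, abs_of_pos hr]
    nlinarith
  simpa using hd.circleAverage

theorem cauchyT_zero (μ : Measure ℂ) (g : ℂ → ℂ) : cauchyT μ g 0 = ∫ ξ, g ξ ∂μ := by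
  simp [cauchyT]

section cauchyT

variable {μ : Measure ℂ} [IsProbabilityMeasure μ] {g : ℂ → ℂ} {C : ℝ}

theorem norm_div_one_sub_le (hC : ∀ z, ‖g z‖ ≤ C) {ξ w : ℂ} (hξ : ‖ξ‖ = 1) (hw : ‖w‖ < 1) :
    ‖g ξ / (1 - conj ξ * w)‖ ≤ C / (1 - ‖w‖) := by
  rw [norm_div]
  exact div_le_div₀ ((norm_nonneg _).trans (hC ξ)) (hC ξ) (by linarith)
    (one_sub_norm_le_norm_one_sub_conj_mul hξ)

theorem measurable_div_one_sub (hg : Measurable g) (w : ℂ) :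
    Measurable fun ξ => g ξ / (1 - conj ξ * w) :=
  hg.div (measurable_const.sub ((continuous_conj.measurable).mul measurable_const))

theorem integrable_div_one_sub (hμ : ∀ᵐ ξ ∂μ, ‖ξ‖ = 1) (hg : Measurable g)
    (hC : ∀ z, ‖g z‖ ≤ C) {w : ℂ} (hw : ‖w‖ < 1) :
    Integrable (fun ξ => g ξ / (1 - conj ξ * w)) μ :=
  Integrable.of_bound (measurable_div_one_sub hg w).aestronglyMeasurable _
    (hμ.mono fun _ hξ => norm_div_one_sub_le hC hξ hw)

theorem measurable_cauchyT (hg : Measurable g) : Measurable (cauchyT μ g) := by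
  refine (StronglyMeasurable.integral_prod_right (ν := μ)
    (f := fun w ξ => g ξ / (1 - conj ξ * w)) ?_).measurable
  refine Measurable.stronglyMeasurable ?_
  exact (hg.comp measurable_snd).div (measurable_const.sub
    ((continuous_conj.measurable.comp measurable_snd).mul measurable_fst))

theorem differentiableOn_cauchyT (hμ : ∀ᵐ ξ ∂μ, ‖ξ‖ = 1) (hg : Measurable g)
    (hC : ∀ z, ‖g z‖ ≤ C) : DifferentiableOn ℂ (cauchyT μ g) (ball 0 1) := by
  intro w hw
  rw [mem_ball_zero_iff] at hw
  obtain ⟨ρ, hρ, hρ1⟩ := exists_between hw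
  have hnhds : ball (0 : ℂ) ρ ∈ 𝓝 w := isOpen_ball.mem_nhds (by simpa using hρ)
  have hd := hasDerivAt_integral_of_dominated_loc_of_deriv_le (μ := μ) (𝕜 := ℂ)
    (F := fun w ξ => g ξ / (1 - conj ξ * w))
    (F' := fun w ξ => g ξ * conj ξ / (1 - conj ξ * w) ^ 2)
    (bound := fun _ => C / (1 - ρ) ^ 2) hnhds
    (Eventually.of_forall fun w => (measurable_div_one_sub hg w).aestronglyMeasurable)
    (integrable_div_one_sub hμ hg hC hw)
    ((hg.mul continuous_conj.measurable).div ((measurable_const.sub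
      ((continuous_conj.measurable).mul measurable_const)).pow_const 2)).aestronglyMeasurable
    ?_ (integrable_const _) ?_
  · exact hd.2.differentiableAt.differentiableWithinAt
  · filter_upwards [hμ] with ξ hξ x hx
    have hx' : ‖x‖ < ρ := by simpa using hx
    rw [norm_div, norm_mul, norm_pow, RCLike.norm_conj, hξ, mul_one]
    have h1 := one_sub_norm_le_norm_one_sub_conj_mul (w := x) hξ
    have h2 : 0 < 1 - ρ := by linarith
    exact div_le_div₀ ((norm_nonneg _).trans (hC ξ)) (hC ξ) (by positivity)
      (pow_le_pow_left₀ h2.le (by linarith) 2)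
  · filter_upwards [hμ] with ξ hξ x hx
    have hx' : ‖x‖ < ρ := by simpa using hx
    have h1 := one_sub_norm_le_norm_one_sub_conj_mul (w := x) hξ
    have h0 : 1 - conj ξ * x ≠ 0 := by
      rw [← norm_pos_iff]; linarith
    have := ((hasDerivAt_const x (g ξ)).div
      ((hasDerivAt_const x (1 : ℂ)).sub ((hasDerivAt_id x).const_mul (conj ξ))) h0)
    refine this.congr_deriv ?_
    simp

theorem discPoisson_nonneg {w : ℂ} (hw : ‖w‖ < 1) (ξ : ℂ) : 0 ≤ discPoisson w ξ := by
  unfold discPoisson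
  have : 0 ≤ 1 - ‖w‖ ^ 2 := by nlinarith [norm_nonneg w]
  positivity

theorem div_add_conj_sub_eq_mul_discPoisson {ξ w : ℂ} (hξ : ‖ξ‖ = 1) (hw : ‖w‖ < 1) (c : ℂ) :
    c / (1 - conj ξ * w) + conj (conj c / (1 - conj ξ * w)) - c = c * discPoisson w ξ := by
  have h1 := one_sub_norm_le_norm_one_sub_conj_mul (w := w) hξ
  have h0 : 1 - conj ξ * w ≠ 0 := by rw [← norm_pos_iff]; linarith
  have h0' : 1 - ξ * conj w ≠ 0 := by
    intro h; apply h0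
    have := congrArg conj h
    simpa using this
  have hn : ((‖1 - conj ξ * w‖ ^ 2 : ℝ) : ℂ) = (1 - conj ξ * w) * (1 - ξ * conj w) := by
    rw [ofReal_pow, ← Complex.mul_conj']; simp
  have hw2 : ((‖w‖ ^ 2 : ℝ) : ℂ) = w * conj w := by
    rw [ofReal_pow, ← Complex.mul_conj']
  have hξ2 : ξ * conj ξ = 1 := by rw [Complex.mul_conj', hξ]; simp
  have : (discPoisson w ξ : ℂ) = (1 - w * conj w) / ((1 - conj ξ * w) * (1 - ξ * conj w)) := by
    rw [discPoisson, ofReal_div, hn, ofReal_sub, hw2, ofReal_one]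
  rw [this]
  simp only [map_div₀, map_sub, map_one, map_mul, conj_conj]
  field_simp
  linear_combination (-(c * w * conj w)) * hξ2

theorem cauchyT_add_conj_sub_eq (hμ : ∀ᵐ ξ ∂μ, ‖ξ‖ = 1) (hg : Measurable g)
    (hC : ∀ z, ‖g z‖ ≤ C) {w : ℂ} (hw : ‖w‖ < 1) :
    cauchyT μ g w + conj (cauchyT μ (fun ξ => conj (g ξ)) w) - ∫ ξ, g ξ ∂μ
      = ∫ ξ, g ξ * discPoisson w ξ ∂μ := by
  have hgc : Measurable fun ξ => conj (g ξ) := continuous_conj.measurable.comp hg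
  have hCc : ∀ z, ‖conj (g z)‖ ≤ C := fun z => by rw [RCLike.norm_conj]; exact hC z
  have i1 := integrable_div_one_sub hμ hg hC hw
  have i2 := integrable_div_one_sub hμ hgc hCc hw
  have i3 : Integrable g μ := Integrable.of_bound hg.aestronglyMeasurable C (ae_of_all _ hC)
  have i2' : Integrable (fun ξ => conj (conj (g ξ) / (1 - conj ξ * w))) μ :=
    (LinearIsometryEquiv.integrable_comp_iff (conjLIE)).2 i2
  have i12 : Integrable (fun ξ => g ξ / (1 - conj ξ * w)
      + conj (conj (g ξ) / (1 - conj ξ * w))) μ := i1.add i2'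
  rw [cauchyT, cauchyT, ← integral_conj, ← integral_add i1 i2', ← integral_sub i12 i3]
  refine integral_congr_ae ?_
  filter_upwards [hμ] with ξ hξ
  exact div_add_conj_sub_eq_mul_discPoisson hξ hw (g ξ)

end cauchyT

theorem integral_discPoisson_nonneg {μ : Measure ℂ} {w : ℂ} (hw : ‖w‖ < 1) :
    0 ≤ ∫ ξ, discPoisson w ξ ∂μ :=
  integral_nonneg fun ξ => discPoisson_nonneg hw ξ

section qG

variable {μ : Measure ℂ} [IsProbabilityMeasure μ] {γ : ℂ}

theorem R1t_eq_cauchyT_sub_one (hμ : ∀ᵐ ξ ∂μ, ‖ξ‖ = 1) {w : ℂ} (hw : ‖w‖ < 1) :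
    R1t μ w = cauchyT μ (fun _ => 1) w - 1 := by
  have i1 := integrable_div_one_sub (g := fun _ => (1 : ℂ)) (C := 1) hμ measurable_const
    (by simp) hw
  have h1 : (1 : ℂ) = ∫ _, (1 : ℂ) ∂μ := by simp
  rw [R1t, cauchyT]
  conv_rhs => rw [h1]
  rw [← integral_sub (by simpa using i1) (integrable_const _)]
  refine integral_congr_ae ?_
  filter_upwards [hμ] with ξ hξ
  have h1 := one_sub_norm_le_norm_one_sub_conj_mul (w := w) hξ
  have h0 : 1 - conj ξ * w ≠ 0 := by rw [← norm_pos_iff]; linarith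
  simp only [integral_const, probReal_univ, one_smul]
  field_simp
  ring

theorem integral_discPoisson_eq (hμ : ∀ᵐ ξ ∂μ, ‖ξ‖ = 1) {w : ℂ} (hw : ‖w‖ < 1) :
    R1t μ w + conj (R1t μ w) + 1 = ((∫ ξ, discPoisson w ξ ∂μ : ℝ) : ℂ) := by
  have h := cauchyT_add_conj_sub_eq (g := fun _ => (1 : ℂ)) (C := 1) hμ measurable_const
    (by simp) hw
  simp only [map_one, integral_const, probReal_univ, one_smul, one_mul] at h
  rw [integral_complex_ofReal] at h
  rw [R1t_eq_cauchyT_sub_one hμ hw, map_sub, map_one, ← h]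
  ring

theorem one_sub_conj_ne_zero (hγ : ‖γ‖ < 1) : 1 - conj γ ≠ 0 := by
  have := one_sub_norm_le_norm_one_sub_conj_mul (ξ := 1) (w := conj γ) (by simp)
  simp only [map_one, one_mul, RCLike.norm_conj] at this
  rw [← norm_pos_iff]; linarith

/-- Real part of the denominator of `qG`, after normalization. -/
theorem qG_denominator_identity (hμ : ∀ᵐ ξ ∂μ, ‖ξ‖ = 1) {w : ℂ} (hw : ‖w‖ < 1) :
    (1 - conj γ) * conj (1 + (1 - conj γ) * R1t μ w)
      + conj (1 - conj γ) * (1 + (1 - conj γ) * R1t μ w)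
      = ((1 - ‖γ‖ ^ 2 + ‖1 - conj γ‖ ^ 2 * ∫ ξ, discPoisson w ξ ∂μ : ℝ) : ℂ) := by
  push_cast
  rw [← Complex.mul_conj', ← Complex.mul_conj', ← integral_discPoisson_eq hμ hw]
  simp only [map_add, map_mul, map_sub, map_one, conj_conj]
  ring

theorem qG_denominator_ne_zero (hμ : ∀ᵐ ξ ∂μ, ‖ξ‖ = 1) (hγ : ‖γ‖ < 1) {w : ℂ} (hw : ‖w‖ < 1) :
    1 + (1 - conj γ) * R1t μ w ≠ 0 := by
  intro h
  have h1 := qG_denominator_identity (γ := γ) hμ hw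
  rw [h, map_zero, mul_zero, mul_zero, add_zero] at h1
  have h2 : 1 - ‖γ‖ ^ 2 + ‖1 - conj γ‖ ^ 2 * ∫ ξ, discPoisson w ξ ∂μ = 0 := by
    exact_mod_cast h1.symm
  have h3 := integral_discPoisson_nonneg (μ := μ) hw
  have h4 : 0 < 1 - ‖γ‖ ^ 2 := by nlinarith [norm_nonneg γ]
  have : 0 ≤ ‖1 - conj γ‖ ^ 2 * ∫ ξ, discPoisson w ξ ∂μ := by positivity
  linarith

theorem qG_ne_zero (hμ : ∀ᵐ ξ ∂μ, ‖ξ‖ = 1) (hγ : ‖γ‖ < 1) {w : ℂ} (hw : ‖w‖ < 1) :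
    qG γ μ w ≠ 0 :=
  div_ne_zero (one_sub_conj_ne_zero hγ) (qG_denominator_ne_zero hμ hγ hw)

theorem two_mul_re_qG (hμ : ∀ᵐ ξ ∂μ, ‖ξ‖ = 1) (hγ : ‖γ‖ < 1) {w : ℂ} (hw : ‖w‖ < 1) :
    2 * (qG γ μ w).re = ((1 - ‖γ‖ ^ 2) / ‖1 - conj γ‖ ^ 2 + ∫ ξ, discPoisson w ξ ∂μ)
      * ‖qG γ μ w‖ ^ 2 := by
  have h := qG_denominator_identity (γ := γ) hμ hw
  have hD := qG_denominator_ne_zero hμ hγ hw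
  have ha := one_sub_conj_ne_zero hγ
  rw [qG]
  set D := 1 + (1 - conj γ) * R1t μ w
  set a := 1 - conj γ
  set P := ∫ ξ, discPoisson w ξ ∂μ
  have hD' : conj D ≠ 0 := (map_ne_zero _).2 hD
  have hnD : ‖D‖ ≠ 0 := norm_ne_zero_iff.2 hD
  have hna : ‖a‖ ≠ 0 := norm_ne_zero_iff.2 ha
  have h2 : ((2 * (a / D).re : ℝ) : ℂ) = a / D + conj (a / D) := by
    rw [Complex.add_conj]
  have h3 : a / D + conj (a / D) = (a * conj D + conj a * D) / (‖D‖ ^ 2 : ℝ) := by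
    rw [ofReal_pow, ← Complex.mul_conj', map_div₀]
    field_simp
  rw [h3, h, ← ofReal_div] at h2
  rw [ofReal_inj.1 h2, norm_div]
  field_simp

theorem re_qG_pos (hμ : ∀ᵐ ξ ∂μ, ‖ξ‖ = 1) (hγ : ‖γ‖ < 1) {w : ℂ} (hw : ‖w‖ < 1) :
    0 < (qG γ μ w).re := by
  have h := two_mul_re_qG hμ hγ hw
  have h1 : 0 < ‖qG γ μ w‖ := norm_pos_iff.2 (qG_ne_zero hμ hγ hw)
  have h2 : 0 < ‖1 - conj γ‖ := norm_pos_iff.2 (one_sub_conj_ne_zero hγ)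
  have h3 := integral_discPoisson_nonneg (μ := μ) hw
  have h4 : 0 < 1 - ‖γ‖ ^ 2 := by nlinarith [norm_nonneg γ]
  have : 0 < 2 * (qG γ μ w).re := by rw [h]; positivity
  linarith

theorem mul_norm_qG_sq_le (hμ : ∀ᵐ ξ ∂μ, ‖ξ‖ = 1) (hγ : ‖γ‖ < 1) {w : ℂ} (hw : ‖w‖ < 1) :
    (1 - ‖γ‖ ^ 2) / ‖1 - conj γ‖ ^ 2 * ‖qG γ μ w‖ ^ 2 ≤ 2 * (qG γ μ w).re := by
  rw [two_mul_re_qG hμ hγ hw]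
  have h3 := integral_discPoisson_nonneg (μ := μ) hw
  gcongr
  linarith

theorem norm_qG_le (hμ : ∀ᵐ ξ ∂μ, ‖ξ‖ = 1) (hγ : ‖γ‖ < 1) {w : ℂ} (hw : ‖w‖ < 1) :
    ‖qG γ μ w‖ ≤ 2 * ‖1 - conj γ‖ ^ 2 / (1 - ‖γ‖ ^ 2) := by
  have h := mul_norm_qG_sq_le hμ hγ hw
  have h1 : 0 < ‖qG γ μ w‖ := norm_pos_iff.2 (qG_ne_zero hμ hγ hw)
  have h2 : 0 < ‖1 - conj γ‖ := norm_pos_iff.2 (one_sub_conj_ne_zero hγ)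
  have h4 : 0 < 1 - ‖γ‖ ^ 2 := by nlinarith [norm_nonneg γ]
  have h5 := re_le_norm (qG γ μ w)
  have h6 : (1 - ‖γ‖ ^ 2) / ‖1 - conj γ‖ ^ 2 * ‖qG γ μ w‖ ≤ 2 := by
    by_contra! hc
    nlinarith [mul_lt_mul_of_pos_right hc h1]
  rw [div_mul_eq_mul_div, div_le_iff₀ (by positivity)] at h6
  rw [le_div_iff₀ h4]
  linarith

theorem differentiableOn_qG (hμ : ∀ᵐ ξ ∂μ, ‖ξ‖ = 1) (hγ : ‖γ‖ < 1) :
    DifferentiableOn ℂ (qG γ μ) (ball 0 1) := by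
  have h1 : DifferentiableOn ℂ (R1t μ) (ball 0 1) := by
    refine ((differentiableOn_cauchyT (g := fun _ => (1 : ℂ)) (C := 1) hμ measurable_const
      (by simp)).sub_const 1).congr fun w hw => ?_
    exact R1t_eq_cauchyT_sub_one hμ (by simpa using hw)
  refine (differentiableOn_const _).div ((h1.const_mul _).const_add _) fun w hw => ?_
  exact qG_denominator_ne_zero hμ hγ (by simpa using hw)

theorem measurable_qG : Measurable (qG γ μ) := by
  have h : Measurable (R1t μ) := by
    refine (StronglyMeasurable.integral_prod_right (ν := μ)
      (f := fun w ξ => (conj ξ * w) / (1 - conj ξ * w)) ?_).measurable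
    have h1 : Measurable fun p : ℂ × ℂ => conj p.2 * p.1 :=
      (continuous_conj.measurable.comp measurable_snd).mul measurable_fst
    exact (h1.div (measurable_const.sub h1)).stronglyMeasurable
  exact measurable_const.div (measurable_const.add (measurable_const.mul h))

/-- `qG` recovered from `θ_γ`. -/
theorem qG_eq_thetaG (hμ : ∀ᵐ ξ ∂μ, ‖ξ‖ = 1) (hγ : ‖γ‖ < 1) {w : ℂ} (hw : ‖w‖ < 1) :
    qG γ μ w = (1 - conj γ) * (1 - γ - (1 - conj γ) * thetaG γ μ w) / (1 - (‖γ‖ : ℂ) ^ 2) := by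
  have hD := qG_denominator_ne_zero hμ hγ hw
  have h4 : (1 - (‖γ‖ : ℂ) ^ 2) ≠ 0 := by
    have : 1 - ‖γ‖ ^ 2 ≠ 0 := by nlinarith [norm_nonneg γ]
    exact_mod_cast this
  rw [qG, thetaG, eq_div_iff h4]
  field_simp
  rw [← Complex.mul_conj']
  ring

end qG

section levelEstimate

variable {μ : Measure ℂ} [IsProbabilityMeasure μ] {γ : ℂ} {f : ℂ → ℂ} {C : ℝ}

/-- The Cauchy transform from outside the disc, evaluated at the reflection of `w`. -/
def cauchyTOut (μ : Measure ℂ) (f : ℂ → ℂ) (w : ℂ) : ℂ :=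
  ∫ ξ, f ξ ∂μ - conj (cauchyT μ (fun ξ => conj (f ξ)) w)

theorem norm_add_conj_mul_sq (a b q : ℂ) :
    ‖a * q + b * conj q‖ ^ 2 = ‖q‖ ^ 2 * ‖a - b‖ ^ 2 + 2 * q.re * (2 * (q * a * conj b).re) := by
  simp only [← Complex.normSq_eq_norm_sq, Complex.normSq_apply, add_re, add_im, sub_re, sub_im,
    mul_re, mul_im, conj_re, conj_im]
  ring

theorem norm_cauchyT_sub_cauchyTOut_sq_le (hμ : ∀ᵐ ξ ∂μ, ‖ξ‖ = 1) (hf : Measurable f)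
    (hC : ∀ z, ‖f z‖ ≤ C) {w : ℂ} (hw : ‖w‖ < 1) :
    0 ≤ (2 * cauchyT μ (fun ξ => ((‖f ξ‖ ^ 2 : ℝ) : ℂ)) w
        - ((∫ ξ, ‖f ξ‖ ^ 2 ∂μ : ℝ) : ℂ)).re ∧
    ‖cauchyT μ f w - cauchyTOut μ f w‖ ^ 2 ≤
      (2 * cauchyT μ (fun ξ => ((‖f ξ‖ ^ 2 : ℝ) : ℂ)) w - ((∫ ξ, ‖f ξ‖ ^ 2 ∂μ : ℝ) : ℂ)).re
        * ∫ ξ, discPoisson w ξ ∂μ := by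
  have hm2 : Measurable fun ξ => ((‖f ξ‖ ^ 2 : ℝ) : ℂ) :=
    measurable_ofReal.comp (hf.norm.pow_const 2)
  have hC2 : ∀ z, ‖((‖f z‖ ^ 2 : ℝ) : ℂ)‖ ≤ C ^ 2 := fun z => by
    rw [norm_real, Real.norm_of_nonneg (by positivity)]
    exact pow_le_pow_left₀ (norm_nonneg _) (hC z) 2
  have e1 : cauchyT μ f w - cauchyTOut μ f w = ∫ ξ, f ξ * discPoisson w ξ ∂μ := by
    rw [← cauchyT_add_conj_sub_eq hμ hf hC hw, cauchyTOut]
    ring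
  have e2 : (2 * cauchyT μ (fun ξ => ((‖f ξ‖ ^ 2 : ℝ) : ℂ)) w
      - ((∫ ξ, ‖f ξ‖ ^ 2 ∂μ : ℝ) : ℂ)).re = ∫ ξ, ‖f ξ‖ ^ 2 * discPoisson w ξ ∂μ := by
    have h := cauchyT_add_conj_sub_eq hμ hm2 hC2 hw
    simp only [conj_ofReal, ← ofReal_mul] at h
    rw [integral_complex_ofReal, integral_complex_ofReal] at h
    have h' := congrArg re h
    rw [ofReal_re] at h'
    rw [← h']
    simp only [sub_re, add_re, conj_re, ofReal_re, mul_re, re_ofNat, im_ofNat, zero_mul, sub_zero]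
    ring
  have hpm : Measurable (discPoisson w) := by
    unfold discPoisson
    exact measurable_const.div ((measurable_const.sub
      ((continuous_conj.measurable).mul measurable_const)).norm.pow_const 2)
  have hpb : ∀ᵐ ξ ∂μ, ‖discPoisson w ξ‖ ≤ (1 - ‖w‖ ^ 2) / (1 - ‖w‖) ^ 2 := by
    filter_upwards [hμ] with ξ hξ
    rw [Real.norm_of_nonneg (discPoisson_nonneg hw ξ), discPoisson]
    have h1 := one_sub_norm_le_norm_one_sub_conj_mul (w := w) hξ
    have h2 : 0 < 1 - ‖w‖ := by linarith
    have h3 : 0 ≤ 1 - ‖w‖ ^ 2 := by nlinarith [norm_nonneg w]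
    gcongr
  have ip : Integrable (discPoisson w) μ := Integrable.of_bound hpm.aestronglyMeasurable _ hpb
  have ifp : Integrable (fun ξ => ‖f ξ‖ ^ 2 * discPoisson w ξ) μ := by
    refine ip.bdd_mul (c := C ^ 2) (hf.norm.pow_const 2).aestronglyMeasurable
      (ae_of_all _ fun z => ?_)
    rw [Real.norm_of_nonneg (by positivity)]
    exact pow_le_pow_left₀ (norm_nonneg _) (hC z) 2
  have hp0 := discPoisson_nonneg hw
  have h0 : ∀ ξ, 0 ≤ ‖f ξ‖ ^ 2 * discPoisson w ξ := fun ξ => mul_nonneg (by positivity) (hp0 ξ)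
  rw [e1, e2]
  refine ⟨integral_nonneg h0, ?_⟩
  have key := norm_integral_le_sqrt_mul_sqrt (h := fun ξ => f ξ * discPoisson w ξ) ifp ip
    (ae_of_all _ h0) (ae_of_all _ hp0) (ae_of_all _ fun ξ => le_of_eq (by
      rw [norm_mul, norm_real, Real.norm_of_nonneg (hp0 ξ)]; ring))
  calc _ ≤ _ := pow_le_pow_left₀ (norm_nonneg _) key 2
    _ = _ := by
      rw [mul_pow, Real.sq_sqrt (integral_nonneg h0), Real.sq_sqrt (integral_nonneg hp0)]

/-- The boundedness estimate for the regularized kernel on the circle of radius `r < 1`. -/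
theorem norm_integral_regularized_le (hμ : ∀ᵐ ξ ∂μ, ‖ξ‖ = 1) (hγ : ‖γ‖ < 1) (hf : Measurable f)
    (hC : ∀ z, ‖f z‖ ≤ C) {ψ : ℂ → ℂ} (hψ : Measurable ψ) {M : ℝ} (hM : ∀ z, ‖ψ z‖ ≤ M)
    {r : ℝ} (hr : 0 < r) (hr1 : r < 1) :
    ‖∫ z, (cauchyT μ f (r * z) * qG γ μ (r * z) + cauchyTOut μ f (r * z) * conj (qG γ μ (r * z)))
        * conj (ψ z) ∂circleMeasure‖
      ≤ Real.sqrt (∫ ξ, ‖f ξ‖ ^ 2 ∂μ) *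
        Real.sqrt (∫ z, ‖ψ z‖ ^ 2 * (2 * (qG γ μ (r * z)).re) ∂circleMeasure) := by
  have hfc : Measurable fun ξ => conj (f ξ) := continuous_conj.measurable.comp hf
  have hCc : ∀ z, ‖conj (f z)‖ ≤ C := fun z => by rw [RCLike.norm_conj]; exact hC z
  have hm2 : Measurable fun ξ => ((‖f ξ‖ ^ 2 : ℝ) : ℂ) :=
    measurable_ofReal.comp (hf.norm.pow_const 2)
  have hC2 : ∀ z, ‖((‖f z‖ ^ 2 : ℝ) : ℂ)‖ ≤ C ^ 2 := fun z => by
    rw [norm_real, Real.norm_of_nonneg (by positivity)]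
    exact pow_le_pow_left₀ (norm_nonneg _) (hC z) 2
  set H : ℂ → ℂ := fun w => 2 * cauchyT μ (fun ξ => ((‖f ξ‖ ^ 2 : ℝ) : ℂ)) w
      - ((∫ ξ, ‖f ξ‖ ^ 2 ∂μ : ℝ) : ℂ) + 2 * (qG γ μ w * cauchyT μ f w *
        (conj (∫ ξ, f ξ ∂μ) - cauchyT μ (fun ξ => conj (f ξ)) w)) with hH
  have dq := differentiableOn_qG (γ := γ) hμ hγ
  have mq := measurable_qG (γ := γ) (μ := μ)
  have dH : DifferentiableOn ℂ H (ball 0 1) :=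
    (((differentiableOn_cauchyT hμ hm2 hC2).const_mul 2).sub_const _).add
      (((dq.mul (differentiableOn_cauchyT hμ hf hC)).mul
        ((differentiableOn_cauchyT hμ hfc hCc).const_sub _)).const_mul 2)
  have mH : Measurable H :=
    ((measurable_const.mul (measurable_cauchyT hm2)).sub_const _).add
      (measurable_const.mul ((mq.mul (measurable_cauchyT hf)).mul
        (measurable_const.sub (measurable_cauchyT hfc))))
  have hH0 : H 0 = ((∫ ξ, ‖f ξ‖ ^ 2 ∂μ : ℝ) : ℂ) := by
    simp only [hH, cauchyT_zero]
    rw [integral_conj, integral_complex_ofReal]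
    ring
  have iH := integrable_comp_mul_circleMeasure dH mH hr hr1
  have eH : ∫ z, (H (r * z)).re ∂circleMeasure = ∫ ξ, ‖f ξ‖ ^ 2 ∂μ := by
    have h1 := integral_re iH
    rw [integral_comp_mul_circleMeasure dH mH hr hr1, hH0] at h1
    simpa using h1
  have iq : Integrable (fun z => (qG γ μ (r * z)).re) circleMeasure :=
    (integrable_comp_mul_circleMeasure dq mq hr hr1).re
  have iB : Integrable (fun z => ‖ψ z‖ ^ 2 * (2 * (qG γ μ (r * z)).re)) circleMeasure := by
    refine (iq.const_mul 2).bdd_mul (c := M ^ 2) (hψ.norm.pow_const 2).aestronglyMeasurable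
      (ae_of_all _ fun z => ?_)
    rw [Real.norm_of_nonneg (by positivity)]
    exact pow_le_pow_left₀ (norm_nonneg _) (hM z) 2
  have key : ∀ w : ℂ, ‖w‖ < 1 →
      ‖cauchyT μ f w * qG γ μ w + cauchyTOut μ f w * conj (qG γ μ w)‖ ^ 2
        ≤ (H w).re * (2 * (qG γ μ w).re) := by
    intro w hw
    obtain ⟨hS, hF⟩ := norm_cauchyT_sub_cauchyTOut_sq_le hμ hf hC hw
    have hq := two_mul_re_qG (μ := μ) hμ hγ hw
    have hq0 := re_qG_pos (μ := μ) hμ hγ hw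
    have hP := integral_discPoisson_nonneg (μ := μ) hw
    rw [norm_add_conj_mul_sq]
    have hHre : (H w).re = (2 * cauchyT μ (fun ξ => ((‖f ξ‖ ^ 2 : ℝ) : ℂ)) w
        - ((∫ ξ, ‖f ξ‖ ^ 2 ∂μ : ℝ) : ℂ)).re
          + 2 * (qG γ μ w * cauchyT μ f w * conj (cauchyTOut μ f w)).re := by
      rw [hH, add_re]
      congr 1
      rw [cauchyTOut, map_sub, conj_conj]
      simp only [mul_re, re_ofNat, im_ofNat, zero_mul, sub_zero]
    rw [hHre]
    set S := (2 * cauchyT μ (fun ξ => ((‖f ξ‖ ^ 2 : ℝ) : ℂ)) w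
        - ((∫ ξ, ‖f ξ‖ ^ 2 ∂μ : ℝ) : ℂ)).re
    set P := ∫ ξ, discPoisson w ξ ∂μ
    have hκ : 0 < (1 - ‖γ‖ ^ 2) / ‖1 - conj γ‖ ^ 2 := by
      have h2 : 0 < ‖1 - conj γ‖ := norm_pos_iff.2 (one_sub_conj_ne_zero hγ)
      have h4 : 0 < 1 - ‖γ‖ ^ 2 := by nlinarith [norm_nonneg γ]
      positivity
    set κ := (1 - ‖γ‖ ^ 2) / ‖1 - conj γ‖ ^ 2
    have h1 : ‖qG γ μ w‖ ^ 2 * ‖cauchyT μ f w - cauchyTOut μ f w‖ ^ 2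
        ≤ ‖qG γ μ w‖ ^ 2 * (S * P) := mul_le_mul_of_nonneg_left hF (sq_nonneg _)
    have h2 : 0 ≤ S * κ * ‖qG γ μ w‖ ^ 2 := by positivity
    nlinarith
  refine (norm_integral_le_sqrt_mul_sqrt (A := fun z => (H (r * z)).re) (iH.re) iB ?_ ?_ ?_).trans
    (le_of_eq (by rw [eH]))
  all_goals
    filter_upwards [ae_norm_eq_one_circleMeasure] with z hz
    have hw : ‖(r : ℂ) * z‖ < 1 := by simp [hz, abs_of_pos hr, hr1]
    have hk := key _ hw
    have hq0 := re_qG_pos (γ := γ) hμ hγ hw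
  · exact nonneg_of_mul_nonneg_left ((sq_nonneg _).trans hk) (by linarith)
  · simp only [Pi.zero_apply]; positivity
  · rw [norm_mul, mul_pow, RCLike.norm_conj]
    calc _ ≤ _ := mul_le_mul_of_nonneg_right hk (sq_nonneg ‖ψ z‖)
      _ = _ := by ring

end levelEstimate

section boundary

variable {μ : Measure ℂ} [IsProbabilityMeasure μ] {γ : ℂ}

theorem tendsto_radial_of_NTlimIn {F : ℂ → ℂ} {z L : ℂ} (hz : ‖z‖ = 1) (h : NTlimIn F z L) :
    Tendsto (fun r : ℝ => F (r * z)) (𝓝[<] 1) (𝓝 L) := by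
  refine (h 2 one_lt_two).comp (tendsto_nhdsWithin_iff.2 ⟨?_, ?_⟩)
  · have : Tendsto (fun r : ℝ => (r : ℂ) * z) (𝓝 1) (𝓝 (((1 : ℝ) : ℂ) * z)) :=
      Continuous.tendsto (by fun_prop) 1
    rw [ofReal_one, one_mul] at this
    exact this.mono_left nhdsWithin_le_nhds
  · filter_upwards [Ioo_mem_nhdsLT (zero_lt_one' ℝ)] with r hr
    have h1 : ‖(r : ℂ) * z‖ = r := by simp [hz, abs_of_pos hr.1]
    have h2 : ‖(r : ℂ) * z - z‖ = 1 - r := by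
      have : (r : ℂ) * z - z = ((r - 1 : ℝ) : ℂ) * z := by push_cast; ring
      rw [this, norm_mul, hz, mul_one, norm_real, Real.norm_eq_abs, abs_sub_comm,
        abs_of_pos (by linarith [hr.2])]
    refine ⟨h1.trans_lt hr.2, ?_⟩
    rw [h1, h2]
    linarith [hr.2]

/-- The boundary values of `qG`, in terms of those of `θ_γ`. -/
def qBoundary (γ : ℂ) (Θγ : ℂ → ℂ) (z : ℂ) : ℂ :=
  (1 - conj γ) * (1 - γ - (1 - conj γ) * Θγ z) / (1 - (‖γ‖ : ℂ) ^ 2)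

theorem tendsto_qG_radial (hμ : ∀ᵐ ξ ∂μ, ‖ξ‖ = 1) (hγ : ‖γ‖ < 1) {Θγ : ℂ → ℂ} {z : ℂ}
    (hz : ‖z‖ = 1) (h : NTlimIn (thetaG γ μ) z (Θγ z)) :
    Tendsto (fun r : ℝ => qG γ μ (r * z)) (𝓝[<] 1) (𝓝 (qBoundary γ Θγ z)) := by
  have h1 : Tendsto (fun r : ℝ => (1 - conj γ) * (1 - γ - (1 - conj γ) * thetaG γ μ (r * z))
      / (1 - (‖γ‖ : ℂ) ^ 2)) (𝓝[<] 1) (𝓝 (qBoundary γ Θγ z)) :=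
    ((((tendsto_radial_of_NTlimIn hz h).const_mul _).const_sub _).const_mul _).div_const _
  refine h1.congr' ?_
  filter_upwards [Ioo_mem_nhdsLT (zero_lt_one' ℝ)] with r hr
  exact (qG_eq_thetaG hμ hγ (by simp [hz, abs_of_pos hr.1, hr.2])).symm

theorem vWeight_eq (hγ : ‖γ‖ < 1) {Θγ : ℂ → ℂ} {z : ℂ}
    (h : (1 - ‖γ‖ ^ 2) / ‖1 - conj γ‖ ^ 2 * ‖qBoundary γ Θγ z‖ ^ 2
      ≤ 2 * (qBoundary γ Θγ z).re) :
    vWeight γ Θγ z = 2 * (qBoundary γ Θγ z).re := by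
  have h4 : 0 < 1 - ‖γ‖ ^ 2 := by nlinarith [norm_nonneg γ]
  have ha : 0 < ‖1 - conj γ‖ := norm_pos_iff.2 (one_sub_conj_ne_zero hγ)
  set E := 1 - γ - (1 - conj γ) * Θγ z with hE
  have hq : qBoundary γ Θγ z = (((1 - ‖γ‖ ^ 2)⁻¹ : ℝ) : ℂ) * ((1 - conj γ) * E) := by
    rw [qBoundary]; push_cast; ring
  have hqn : ‖qBoundary γ Θγ z‖ ^ 2 = ((1 - ‖γ‖ ^ 2)⁻¹) ^ 2 * (‖1 - conj γ‖ ^ 2 * ‖E‖ ^ 2) := by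
    rw [hq, norm_mul, norm_mul, norm_real, Real.norm_of_nonneg (by positivity)]; ring
  have hqr : (qBoundary γ Θγ z).re = (1 - ‖γ‖ ^ 2)⁻¹ * ((1 - conj γ) * E).re := by
    rw [hq, re_ofReal_mul]
  have hid : ‖E‖ ^ 2 + ‖1 - conj γ‖ ^ 2 * (1 - ‖Θγ z‖ ^ 2) = 2 * ((1 - conj γ) * E).re := by
    rw [hE]
    simp only [← Complex.normSq_eq_norm_sq, Complex.normSq_apply, sub_re, sub_im,
      mul_re, mul_im, conj_re, conj_im, one_re, one_im]
    ring
  have hΘ : 0 ≤ 1 - ‖Θγ z‖ ^ 2 := by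
    rw [hqn, hqr] at h
    have e1 : (1 - ‖γ‖ ^ 2) / ‖1 - conj γ‖ ^ 2 *
        (((1 - ‖γ‖ ^ 2)⁻¹) ^ 2 * (‖1 - conj γ‖ ^ 2 * ‖E‖ ^ 2)) = (1 - ‖γ‖ ^ 2)⁻¹ * ‖E‖ ^ 2 := by
      field_simp
    rw [e1] at h
    have e2 : ‖E‖ ^ 2 ≤ 2 * ((1 - conj γ) * E).re := by
      have : 0 < (1 - ‖γ‖ ^ 2)⁻¹ := by positivity
      nlinarith
    have e3 : 0 ≤ ‖1 - conj γ‖ ^ 2 * (1 - ‖Θγ z‖ ^ 2) := by linarith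
    exact nonneg_of_mul_nonneg_right e3 (by positivity)
  have e4 : 1 + (conj γ - 1) * Θγ z - γ = E := by rw [hE]; ring
  rw [vWeight, BgammaFst, BgammaSnd, e4, hqr]
  simp only [norm_mul, norm_inv, norm_real, mul_pow, Real.norm_eq_abs, sq_abs, inv_pow]
  rw [Real.sq_sqrt h4.le, Real.sq_sqrt hΘ, norm_sub_rev (conj γ) 1]
  linear_combination (1 - ‖γ‖ ^ 2)⁻¹ * hid

variable {g : ℂ → ℂ} {C δ : ℝ}

theorem half_le_norm_one_sub_conj_mul {ξ z : ℂ} (hξ : ‖ξ‖ = 1) (hz : ‖z‖ = 1)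
    (h : δ ≤ ‖ξ - z‖) {r : ℝ} (hr : 0 < r) (hr1 : r ≤ 1) :
    δ / 2 ≤ ‖1 - conj ξ * (r * z)‖ := by
  have e : ‖1 - conj ξ * (r * z)‖ = ‖ξ - r * z‖ := by
    have h1 : ξ * conj ξ = 1 := by rw [Complex.mul_conj', hξ]; simp
    have h2 : ξ - r * z = ξ * (1 - conj ξ * (r * z)) := by
      linear_combination (r * z : ℂ) * h1
    rw [h2, norm_mul, hξ, one_mul]
  have h1 := one_sub_norm_le_norm_one_sub_conj_mul (w := r * z) hξ
  rw [norm_mul, hz, mul_one, norm_real, Real.norm_of_nonneg hr.le, e] at h1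
  have h2 : ‖(r : ℂ) * z - z‖ = 1 - r := by
    have : (r : ℂ) * z - z = ((r - 1 : ℝ) : ℂ) * z := by push_cast; ring
    rw [this, norm_mul, hz, mul_one, norm_real, Real.norm_eq_abs, abs_sub_comm,
      abs_of_nonneg (by linarith)]
  have h3 := norm_sub_le_norm_sub_add_norm_sub ξ (r * z) z
  rw [e]
  linarith

theorem norm_div_one_sub_le_of_separated (hC : ∀ z, ‖g z‖ ≤ C) (hδ : 0 < δ) {ξ z : ℂ}
    (hξ : ‖ξ‖ = 1) (hz : ‖z‖ = 1) (hsep : g ξ ≠ 0 → δ ≤ ‖ξ - z‖) {r : ℝ} (hr : 0 < r)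
    (hr1 : r ≤ 1) : ‖g ξ / (1 - conj ξ * (r * z))‖ ≤ C / (δ / 2) := by
  have hC0 : 0 ≤ C := (norm_nonneg _).trans (hC 0)
  by_cases h : g ξ = 0
  · rw [h, zero_div, norm_zero]; positivity
  · rw [norm_div]
    exact div_le_div₀ hC0 (hC ξ) (by positivity)
      (half_le_norm_one_sub_conj_mul hξ hz (hsep h) hr hr1)

theorem norm_cauchyT_le_of_separated (hμ : ∀ᵐ ξ ∂μ, ‖ξ‖ = 1) (hC : ∀ z, ‖g z‖ ≤ C)
    (hδ : 0 < δ) {z : ℂ} (hz : ‖z‖ = 1) (hsep : ∀ ξ, g ξ ≠ 0 → δ ≤ ‖ξ - z‖) {r : ℝ}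
    (hr : 0 < r) (hr1 : r ≤ 1) : ‖cauchyT μ g (r * z)‖ ≤ C / (δ / 2) := by
  have := norm_integral_le_of_norm_le_const (μ := μ) (hμ.mono fun ξ hξ =>
    norm_div_one_sub_le_of_separated hC hδ hξ hz (hsep ξ) hr hr1)
  simpa [cauchyT] using this

theorem tendsto_cauchyT_of_separated (hμ : ∀ᵐ ξ ∂μ, ‖ξ‖ = 1) (hg : Measurable g)
    (hC : ∀ z, ‖g z‖ ≤ C) (hδ : 0 < δ) {z : ℂ} (hz : ‖z‖ = 1)
    (hsep : ∀ ξ, g ξ ≠ 0 → δ ≤ ‖ξ - z‖) :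
    Tendsto (fun r : ℝ => cauchyT μ g (r * z)) (𝓝[<] 1) (𝓝 (cauchyT μ g z)) := by
  refine tendsto_integral_filter_of_dominated_convergence (fun _ => C / (δ / 2))
    (Eventually.of_forall fun r => (measurable_div_one_sub hg _).aestronglyMeasurable) ?_
    (integrable_const _) ?_
  · filter_upwards [Ioo_mem_nhdsLT (zero_lt_one' ℝ)] with r hr
    exact hμ.mono fun ξ hξ => norm_div_one_sub_le_of_separated hC hδ hξ hz (hsep ξ) hr.1 hr.2.le
  · filter_upwards [hμ] with ξ hξ
    by_cases h : g ξ = 0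
    · simp [h]
    have h1 := half_le_norm_one_sub_conj_mul hξ hz (hsep ξ h) one_pos le_rfl
    rw [ofReal_one, one_mul] at h1
    have h0 : 1 - conj ξ * z ≠ 0 := by rw [← norm_pos_iff]; linarith
    have h2 : Tendsto (fun r : ℝ => 1 - conj ξ * (r * z)) (𝓝 1)
        (𝓝 (1 - conj ξ * (((1 : ℝ) : ℂ) * z))) := Continuous.tendsto (by fun_prop) 1
    rw [ofReal_one, one_mul] at h2
    exact tendsto_const_nhds.div (h2.mono_left nhdsWithin_le_nhds) h0

theorem norm_cauchyTOut_le_of_separated (hμ : ∀ᵐ ξ ∂μ, ‖ξ‖ = 1) (hC : ∀ z, ‖g z‖ ≤ C)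
    (hδ : 0 < δ) {z : ℂ} (hz : ‖z‖ = 1) (hsep : ∀ ξ, g ξ ≠ 0 → δ ≤ ‖ξ - z‖) {r : ℝ}
    (hr : 0 < r) (hr1 : r ≤ 1) : ‖cauchyTOut μ g (r * z)‖ ≤ C + C / (δ / 2) := by
  refine (norm_sub_le _ _).trans (add_le_add ?_ ?_)
  · simpa using norm_integral_le_of_norm_le_const (μ := μ) (ae_of_all _ hC)
  · rw [RCLike.norm_conj]
    refine norm_cauchyT_le_of_separated hμ (fun z => ?_) hδ hz (fun ξ hξ => hsep ξ ?_) hr hr1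
    · rw [RCLike.norm_conj]; exact hC z
    · simpa using hξ

theorem tendsto_cauchyTOut_of_separated (hμ : ∀ᵐ ξ ∂μ, ‖ξ‖ = 1) (hg : Measurable g)
    (hC : ∀ z, ‖g z‖ ≤ C) (hδ : 0 < δ) {z : ℂ} (hz : ‖z‖ = 1)
    (hsep : ∀ ξ, g ξ ≠ 0 → δ ≤ ‖ξ - z‖) :
    Tendsto (fun r : ℝ => cauchyTOut μ g (r * z)) (𝓝[<] 1) (𝓝 (cauchyT μ g z)) := by
  have hgc : Measurable fun ξ => conj (g ξ) := continuous_conj.measurable.comp hg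
  have hCc : ∀ z, ‖conj (g z)‖ ≤ C := fun z => by rw [RCLike.norm_conj]; exact hC z
  have hsepc : ∀ ξ, conj (g ξ) ≠ 0 → δ ≤ ‖ξ - z‖ := fun ξ hξ => hsep ξ (by simpa using hξ)
  have h1 := ((continuous_conj.tendsto _).comp
    (tendsto_cauchyT_of_separated hμ hgc hCc hδ hz hsepc)).const_sub (∫ ξ, g ξ ∂μ)
  suffices h : cauchyT μ g z = ∫ ξ, g ξ ∂μ - conj (cauchyT μ (fun ξ => conj (g ξ)) z) by
    rw [h]; exact h1
  have i1 : Integrable g μ := Integrable.of_bound hg.aestronglyMeasurable C (ae_of_all _ hC)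
  have i2 : Integrable (fun ξ => conj (g ξ) / (1 - conj ξ * z)) μ := by
    refine Integrable.of_bound (measurable_div_one_sub hgc z).aestronglyMeasurable
      (C / (δ / 2)) (hμ.mono fun ξ hξ => ?_)
    simpa using norm_div_one_sub_le_of_separated hCc hδ hξ hz (hsepc ξ) one_pos le_rfl
  have i2' : Integrable (fun ξ => conj (conj (g ξ) / (1 - conj ξ * z))) μ :=
    (LinearIsometryEquiv.integrable_comp_iff (conjLIE)).2 i2
  rw [cauchyT, cauchyT, ← integral_conj, ← integral_sub i1 i2']
  refine integral_congr_ae ?_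
  filter_upwards [hμ] with ξ hξ
  by_cases h : g ξ = 0
  · simp [h]
  have h1 := half_le_norm_one_sub_conj_mul hξ hz (hsep ξ h) one_pos le_rfl
  rw [ofReal_one, one_mul] at h1
  have h0 : 1 - conj ξ * z ≠ 0 := by rw [← norm_pos_iff]; linarith
  have h0' : 1 - ξ * conj z ≠ 0 := by
    intro h; apply h0
    have := congrArg conj h
    simpa using this
  have hξ2 : ξ * conj ξ = 1 := by rw [Complex.mul_conj', hξ]; simp
  have hz2 : z * conj z = 1 := by rw [Complex.mul_conj', hz]; simp
  simp only [map_div₀, map_sub, map_one, map_mul, conj_conj]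
  field_simp
  linear_combination (-(ξ * conj ξ)) * hz2 - hξ2

end boundary

/-- For `|γ| < 1` and `v(z) = ‖B_γ(z)‖²`, the kernel `K(z,ξ) = 1/(1-ξ̄z)`
is restrictedly bounded from `L²(μ)` to `L²(v dm)` with restricted norm at most `1`. -/
theorem statement10
    (μ : Measure ℂ) [IsProbabilityMeasure μ] (hμ : ∀ᵐ ξ ∂μ, ‖ξ‖ = 1)
    (γ : ℂ) (hγ : ‖γ‖ < 1)
    -- nontangential boundary values of `θ_γ` on the circle:
    (Θγ : ℂ → ℂ)
    (hΘγ : ∀ᵐ z ∂circleMeasure, NTlimIn (thetaG γ μ) z (Θγ z))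
    -- bounded measurable functions with disjoint compact supports:
    (f ψ : ℂ → ℂ) (hfm : Measurable f) (hψm : Measurable ψ)
    (hfbd : ∃ C, ∀ z, ‖f z‖ ≤ C) (hψbd : ∃ C, ∀ z, ‖ψ z‖ ≤ C)
    (hfc : IsCompact (tsupport f)) (hψc : IsCompact (tsupport ψ))
    (hdisj : Disjoint (tsupport f) (tsupport ψ)) :
    ‖∫ z, (∫ ξ, f ξ / (1 - conj ξ * z) ∂μ) * conj (ψ z) * (vWeight γ Θγ z : ℂ)
        ∂circleMeasure‖
      ≤ Real.sqrt (∫ ξ, ‖f ξ‖ ^ 2 ∂μ) *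
          Real.sqrt (∫ z, ‖ψ z‖ ^ 2 * vWeight γ Θγ z ∂circleMeasure) := by
  obtain ⟨C, hC⟩ := hfbd
  obtain ⟨M, hM⟩ := hψbd
  have hM0 : 0 ≤ M := (norm_nonneg _).trans (hM 0)
  have hC0 : 0 ≤ C := (norm_nonneg _).trans (hC 0)
  obtain ⟨δ, hδ, hδsep⟩ := exists_pos_forall_lt_edist hfc hψc.isClosed hdisj
  have hδ' : 0 < (δ : ℝ) := hδ
  have hsep : ∀ z, ψ z ≠ 0 → ∀ ξ, f ξ ≠ 0 → (δ : ℝ) ≤ ‖ξ - z‖ := by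
    intro z hz ξ hξ
    have h := hδsep ξ (subset_tsupport f hξ) z (subset_tsupport ψ hz)
    rw [edist_nndist, ENNReal.coe_lt_coe, ← NNReal.coe_lt_coe, coe_nndist, dist_eq_norm] at h
    exact h.le
  have hev : ∀ᶠ r : ℝ in 𝓝[<] 1, 0 < r ∧ r < 1 := Ioo_mem_nhdsLT (zero_lt_one' ℝ)
  have hin : ∀ {r : ℝ} {z : ℂ}, 0 < r → r < 1 → ‖z‖ = 1 → ‖(r : ℂ) * z‖ < 1 :=
    fun hr hr1 hz => by simp [hz, abs_of_pos hr, hr1]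
  have hv : ∀ᵐ z ∂circleMeasure, vWeight γ Θγ z = 2 * (qBoundary γ Θγ z).re := by
    filter_upwards [ae_norm_eq_one_circleMeasure, hΘγ] with z hz hΘ
    have hq := tendsto_qG_radial hμ hγ hz hΘ
    refine vWeight_eq hγ (le_of_tendsto_of_tendsto ((hq.norm.pow 2).const_mul _)
      (((continuous_re.tendsto _).comp hq).const_mul 2) ?_)
    filter_upwards [hev] with r hr
    exact mul_norm_qG_sq_le hμ hγ (hin hr.1 hr.2 hz)
  set Q := 2 * ‖1 - conj γ‖ ^ 2 / (1 - ‖γ‖ ^ 2)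
  have hQ : ∀ {w : ℂ}, ‖w‖ < 1 → ‖qG γ μ w‖ ≤ Q := fun hw => norm_qG_le hμ hγ hw
  have hrm : ∀ r : ℝ, Measurable fun z : ℂ => (r : ℂ) * z :=
    fun r => measurable_const.mul measurable_id
  have mq : ∀ r : ℝ, Measurable fun z => qG γ μ (r * z) := fun r => measurable_qG.comp (hrm r)
  have mT : ∀ r : ℝ, Measurable fun z => cauchyT μ f (r * z) :=
    fun r => (measurable_cauchyT hfm).comp (hrm r)
  have mO : ∀ r : ℝ, Measurable fun z => cauchyTOut μ f (r * z) := fun r =>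
    (measurable_const.sub (continuous_conj.measurable.comp (measurable_cauchyT
      (continuous_conj.measurable.comp hfm)))).comp (hrm r)
  have hleft : Tendsto (fun r : ℝ => ∫ z, (cauchyT μ f (r * z) * qG γ μ (r * z)
      + cauchyTOut μ f (r * z) * conj (qG γ μ (r * z))) * conj (ψ z) ∂circleMeasure) (𝓝[<] 1)
      (𝓝 (∫ z, (∫ ξ, f ξ / (1 - conj ξ * z) ∂μ) * conj (ψ z) * (vWeight γ Θγ z : ℂ)
        ∂circleMeasure)) := by
    refine tendsto_integral_filter_of_dominated_convergence
      (fun _ => (C / (δ / 2) * Q + (C + C / (δ / 2)) * Q) * M)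
      (Eventually.of_forall fun r => ?_) ?_ (integrable_const _) ?_
    · exact (((mT r).mul (mq r)).add ((mO r).mul (continuous_conj.measurable.comp (mq r)))).mul
        (continuous_conj.measurable.comp hψm) |>.aestronglyMeasurable
    · filter_upwards [hev] with r hr
      filter_upwards [ae_norm_eq_one_circleMeasure] with z hz
      have hq := hQ (hin hr.1 hr.2 hz)
      have hQ0 : 0 ≤ Q := (norm_nonneg _).trans hq
      by_cases h : ψ z = 0
      · rw [h, map_zero, mul_zero, norm_zero]; positivity
      rw [norm_mul, RCLike.norm_conj]
      refine mul_le_mul ?_ (hM z) (norm_nonneg _) (by positivity)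
      refine (norm_add_le _ _).trans ?_
      rw [norm_mul, norm_mul, RCLike.norm_conj]
      exact add_le_add
        (mul_le_mul (norm_cauchyT_le_of_separated hμ hC hδ' hz (hsep z h) hr.1 hr.2.le) hq
          (norm_nonneg _) (by positivity))
        (mul_le_mul (norm_cauchyTOut_le_of_separated hμ hC hδ' hz (hsep z h) hr.1 hr.2.le) hq
          (norm_nonneg _) (by positivity))
    · filter_upwards [ae_norm_eq_one_circleMeasure, hΘγ, hv] with z hz hΘ hvz
      by_cases h : ψ z = 0
      · simp [h]
      have hq := tendsto_qG_radial hμ hγ hz hΘ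
      have hlim := (((tendsto_cauchyT_of_separated hμ hfm hC hδ' hz (hsep z h)).mul hq).add
        ((tendsto_cauchyTOut_of_separated hμ hfm hC hδ' hz (hsep z h)).mul
          ((continuous_conj.tendsto _).comp hq))).mul_const (conj (ψ z))
      have e : (∫ ξ, f ξ / (1 - conj ξ * z) ∂μ) * conj (ψ z) * (vWeight γ Θγ z : ℂ)
          = (cauchyT μ f z * qBoundary γ Θγ z + cauchyT μ f z * conj (qBoundary γ Θγ z))
            * conj (ψ z) := by
        rw [hvz, ← Complex.add_conj, cauchyT]
        ring
      rw [e]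
      exact hlim
  have hright : Tendsto (fun r : ℝ => ∫ z, ‖ψ z‖ ^ 2 * (2 * (qG γ μ (r * z)).re) ∂circleMeasure)
      (𝓝[<] 1) (𝓝 (∫ z, ‖ψ z‖ ^ 2 * vWeight γ Θγ z ∂circleMeasure)) := by
    refine tendsto_integral_filter_of_dominated_convergence (fun _ => M ^ 2 * (2 * Q))
      (Eventually.of_forall fun r => ?_) ?_ (integrable_const _) ?_
    · exact ((hψm.norm.pow_const 2).mul
        (measurable_const.mul (measurable_re.comp (mq r)))).aestronglyMeasurable
    · filter_upwards [hev] with r hr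
      filter_upwards [ae_norm_eq_one_circleMeasure] with z hz
      have hq := (abs_re_le_norm _).trans (hQ (hin hr.1 hr.2 hz))
      rw [norm_mul, norm_mul, norm_pow, norm_norm, Real.norm_two, Real.norm_eq_abs]
      exact mul_le_mul (pow_le_pow_left₀ (norm_nonneg _) (hM z) 2) (by linarith)
        (by positivity) (by positivity)
    · filter_upwards [ae_norm_eq_one_circleMeasure, hΘγ, hv] with z hz hΘ hvz
      rw [hvz]
      exact (((continuous_re.tendsto _).comp
        (tendsto_qG_radial hμ hγ hz hΘ)).const_mul 2).const_mul _
  refine le_of_tendsto_of_tendsto hleft.norm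
    (((Real.continuous_sqrt.tendsto _).comp hright).const_mul _) ?_
  filter_upwards [hev] with r hr
  exact norm_integral_regularized_le hμ hγ hfm hC hψm hM hr.1 hr.2
end
end
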